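/- (Polar-type decomposition in 𝔾.) Every M ∈ 𝔾 can be written as M = K·D·U, where K and U are unitary matrices in 𝔾 with det(K) = det(U) = 1, and D is a diagonal matrix of the form D = diag(a₁,…,a_d, a₁⁻¹,…,a_d⁻¹, a₁⁻¹,…,a_d⁻¹, a₁,…,a_d) if L = 2d, respectively D = diag(a₁,…,a_d, 1, a₁⁻¹,…,a_d⁻¹, a₁⁻¹,…,a_d⁻¹, 1, a₁,…,a_d) if L = 2d+1, with real numbers a₁ ≥ a₂ ≥ … ≥ a_d ≥ 1. -/

import Mathlib

open Matrix

noncomputable section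

/-- The `2L × 2L` matrix `J = [[0, -1],[1, 0]]`, with index type `Fin L ⊕ Fin L`. -/
def Jmat (L : ℕ) : Matrix (Fin L ⊕ Fin L) (Fin L ⊕ Fin L) ℂ :=
  Matrix.fromBlocks 0 (-1) 1 0

/-- The involution of `{0, …, L−1}` exchanging `i` and `i + (L − d)` for `i < d`,
where `d = ⌊L/2⌋` (it fixes the middle index when `L` is odd). -/
def permIdx (L : ℕ) (i : ℕ) : ℕ :=
  if i < L / 2 then i + (L - L / 2)
  else if L - L / 2 ≤ i then i - (L - L / 2)
  else i

/-- The real symmetric permutation matrix `R` exchanging `e_i` and `e_{L−d+i}` for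
`i < d = ⌊L/2⌋` (viewed as a complex matrix). -/
def Rmat (L : ℕ) : Matrix (Fin L) (Fin L) ℂ :=
  Matrix.of fun i j => if (j : ℕ) = permIdx L (i : ℕ) then 1 else 0

/-- `S = diag(R, R)`. -/
def Smat (L : ℕ) : Matrix (Fin L ⊕ Fin L) (Fin L ⊕ Fin L) ℂ :=
  Matrix.fromBlocks (Rmat L) 0 0 (Rmat L)

/-- The group `𝔾 ≅ SO*(2L)`: matrices `M` with `M* J M = J` and `Mᵀ S M = S`. -/
def Gset (L : ℕ) : Set (Matrix (Fin L ⊕ Fin L) (Fin L ⊕ Fin L) ℂ) :=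
  {M | Mᴴ * Jmat L * M = Jmat L ∧ Mᵀ * Smat L * M = Smat L}

/-- The vector of diagonal entries `a₁, …, a_d, (1,) a₁⁻¹, …, a_d⁻¹` (with the middle `1`
only present when `L` is odd). -/
def dvec (L : ℕ) (A : Fin (L / 2) → ℝ) (i : Fin L) : ℝ :=
  if h : (i : ℕ) < L / 2 then A ⟨i, h⟩
  else if h2 : L - L / 2 ≤ (i : ℕ) then
    (A ⟨(i : ℕ) - (L - L / 2), by have := i.isLt; omega⟩)⁻¹
  else 1

/-- The diagonal matrix `D = diag(a₁,…,a_d,(1,)a₁⁻¹,…,a_d⁻¹,a₁⁻¹,…,a_d⁻¹,(1,)a₁,…,a_d)`. -/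
def Dmat (L : ℕ) (A : Fin (L / 2) → ℝ) :
    Matrix (Fin L ⊕ Fin L) (Fin L ⊕ Fin L) ℂ :=
  Matrix.fromBlocks (Matrix.diagonal fun i => (dvec L A i : ℂ)) 0 0
    (Matrix.diagonal fun i => ((dvec L A i)⁻¹ : ℂ))

open scoped InnerProductSpace

/-- A complex structure `J`, a real structure `θ` commuting with it, and a positive operator `P`
that both of them conjugate to its inverse. -/
structure PolarTriple (E : Type*) [NormedAddCommGroup E] [InnerProductSpace ℂ E] where
  J : E →ₗ[ℂ] E
  θ : E →ₗ⋆[ℂ] E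
  P : E →ₗ[ℂ] E
  J_J : ∀ x, J (J x) = -x
  θ_θ : ∀ x, θ (θ x) = x
  θ_J : ∀ x, θ (J x) = J (θ x)
  inner_J_J : ∀ x y, ⟪J x, J y⟫_ℂ = ⟪x, y⟫_ℂ
  inner_θ_θ : ∀ x y, ⟪θ x, θ y⟫_ℂ = ⟪y, x⟫_ℂ
  inner_P : ∀ x y, ⟪P x, y⟫_ℂ = ⟪x, P y⟫_ℂ
  inner_P_pos : ∀ x, x ≠ 0 → 0 < (⟪x, P x⟫_ℂ).re
  P_J_P : ∀ x, P (J (P x)) = J x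
  P_θ_P : ∀ x, P (θ (P x)) = θ x

namespace PolarTriple

variable {E : Type*} [NormedAddCommGroup E] [InnerProductSpace ℂ E] (T : PolarTriple E)

lemma inner_J_left (x y : E) : ⟪T.J x, y⟫_ℂ = -⟪x, T.J y⟫_ℂ := by
  have h := T.inner_J_J x (T.J y)
  rw [T.J_J, inner_neg_right] at h
  rw [← h, neg_neg]

lemma inner_θ_left (x y : E) : ⟪T.θ x, y⟫_ℂ = ⟪T.θ y, x⟫_ℂ := by
  have h := T.inner_θ_θ x (T.θ y)
  rwa [T.θ_θ] at h

lemma inner_J_θ_self (x : E) : ⟪x, T.J (T.θ x)⟫_ℂ = 0 := by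
  have h1 := T.inner_J_left x (T.θ x)
  have h2 := T.inner_θ_θ (T.θ x) (T.J x)
  rw [T.θ_θ, T.θ_J] at h2
  have : (2 : ℂ) * ⟪x, T.J (T.θ x)⟫_ℂ = 0 := by linear_combination h1 + h2
  simpa using this

lemma norm_J (x : E) : ‖T.J x‖ = ‖x‖ := by
  rw [norm_eq_sqrt_re_inner (𝕜 := ℂ), T.inner_J_J, ← norm_eq_sqrt_re_inner]

lemma P_J {x : E} {l : ℝ} (hl : l ≠ 0) (h : T.P x = (l : ℂ) • x) :
    T.P (T.J x) = ((l⁻¹ : ℝ) : ℂ) • T.J x := by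
  have h1 := T.P_J_P x
  rw [h, map_smul, map_smul] at h1
  nth_rw 2 [← h1]
  rw [smul_smul, ← Complex.ofReal_mul, inv_mul_cancel₀ hl, Complex.ofReal_one, one_smul]

lemma P_θ {x : E} {l : ℝ} (hl : l ≠ 0) (h : T.P x = (l : ℂ) • x) :
    T.P (T.θ x) = ((l⁻¹ : ℝ) : ℂ) • T.θ x := by
  have h1 := T.P_θ_P x
  rw [h, map_smulₛₗ, map_smul, Complex.conj_ofReal] at h1
  nth_rw 2 [← h1]
  rw [smul_smul, ← Complex.ofReal_mul, inv_mul_cancel₀ hl, Complex.ofReal_one, one_smul]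

lemma inner_eq_zero_of_eigen {x y : E} {l m : ℝ} (hx : T.P x = (l : ℂ) • x)
    (hy : T.P y = (m : ℂ) • y) (hlm : l ≠ m) : ⟪x, y⟫_ℂ = 0 := by
  have h := T.inner_P x y
  rw [hx, hy, inner_smul_left, inner_smul_right, Complex.conj_ofReal] at h
  have h2 : ((l : ℂ) - m) * ⟪x, y⟫_ℂ = 0 := by linear_combination h
  rcases mul_eq_zero.mp h2 with h3 | h3
  · exact absurd (by exact_mod_cast sub_eq_zero.mp h3) hlm
  · exact h3

/-- A subspace invariant under `J`, `θ` and `P`. -/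
structure Stable (W : Submodule ℂ E) : Prop where
  J_mem : ∀ x ∈ W, T.J x ∈ W
  θ_mem : ∀ x ∈ W, T.θ x ∈ W
  P_mem : ∀ x ∈ W, T.P x ∈ W

variable {T}

lemma Stable.orthogonal {W : Submodule ℂ E} (h : T.Stable W) : T.Stable Wᗮ := by
  refine ⟨fun x hx => ?_, fun x hx => ?_, fun x hx => ?_⟩ <;>
    rw [Submodule.mem_orthogonal] at hx ⊢ <;> intro y hy
  · rw [← neg_eq_iff_eq_neg.mpr (T.inner_J_left y x), hx _ (h.J_mem y hy), neg_zero]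
  · rw [← inner_conj_symm, T.inner_θ_left, hx _ (h.θ_mem y hy), map_zero]
  · rw [← T.inner_P, hx _ (h.P_mem y hy)]

lemma Stable.inf {W W' : Submodule ℂ E} (h : T.Stable W) (h' : T.Stable W') :
    T.Stable (W ⊓ W') :=
  ⟨fun x hx => ⟨h.J_mem x hx.1, h'.J_mem x hx.2⟩, fun x hx => ⟨h.θ_mem x hx.1, h'.θ_mem x hx.2⟩,
    fun x hx => ⟨h.P_mem x hx.1, h'.P_mem x hx.2⟩⟩

lemma Stable.span {s : Set E} (hJ : ∀ x ∈ s, T.J x ∈ Submodule.span ℂ s)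
    (hθ : ∀ x ∈ s, T.θ x ∈ Submodule.span ℂ s) (hP : ∀ x ∈ s, T.P x ∈ Submodule.span ℂ s) :
    T.Stable (Submodule.span ℂ s) := by
  refine ⟨fun x hx => ?_, fun x hx => ?_, fun x hx => ?_⟩
  · exact (Submodule.span_le (p := (Submodule.span ℂ s).comap T.J)).mpr hJ hx
  · exact (Submodule.span_le (p := (Submodule.span ℂ s).comap T.θ)).mpr hθ hx
  · exact (Submodule.span_le (p := (Submodule.span ℂ s).comap T.P)).mpr hP hx

variable (T)

/-- A unit eigenvector of `P` with eigenvalue `a ^ 2 ≥ 1` such that `v`, `θ v`, `J v` and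
`J (θ v)` are orthogonal. -/
structure Good (a : ℝ) (v : E) : Prop where
  one_le : 1 ≤ a
  P_eq : T.P v = ((a ^ 2 : ℝ) : ℂ) • v
  norm_eq : ‖v‖ = 1
  inner_θ : ⟪v, T.θ v⟫_ℂ = 0
  inner_J : ⟪v, T.J v⟫_ℂ = 0

/-- A unit vector fixed by `θ` and `P`. -/
structure Neutral (u : E) : Prop where
  θ_eq : T.θ u = u
  P_eq : T.P u = u
  norm_eq : ‖u‖ = 1

variable {T}

lemma Neutral.inner_J {u : E} (h : T.Neutral u) : ⟪u, T.J u⟫_ℂ = 0 := by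
  have := T.inner_J_θ_self u
  rwa [h.θ_eq] at this

lemma good_of_one_lt {x : E} {l : ℝ} (hl : 1 < l) (h : T.P x = (l : ℂ) • x) (hx : ‖x‖ = 1) :
    T.Good (√l) x := by
  have hne : l ≠ l⁻¹ := (lt_trans (inv_lt_one_of_one_lt₀ hl) hl).ne'
  refine ⟨Real.one_le_sqrt.mpr hl.le, ?_, hx, ?_, ?_⟩
  · rw [Real.sq_sqrt (by linarith), h]
  · exact T.inner_eq_zero_of_eigen h (T.P_θ (by linarith) h) hne
  · exact T.inner_eq_zero_of_eigen h (T.P_J (by linarith) h) hne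

lemma neutral_smul {y : E} (hy : y ≠ 0) (hθ : T.θ y = y) (hP : T.P y = y) :
    T.Neutral (((‖y‖⁻¹ : ℝ) : ℂ) • y) := by
  refine ⟨?_, ?_, ?_⟩
  · rw [map_smulₛₗ, Complex.conj_ofReal, hθ]
  · rw [map_smul, hP]
  · rw [norm_smul, Complex.norm_real, norm_inv, norm_norm, inv_mul_cancel₀ (norm_ne_zero_iff.mpr hy)]

lemma Stable.exists_eigenvector [FiniteDimensional ℂ E] {W : Submodule ℂ E} (h : T.Stable W)
    (hW : W ≠ ⊥) : ∃ x ∈ W, ∃ l : ℝ, 0 < l ∧ ‖x‖ = 1 ∧ T.P x = (l : ℂ) • x := by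
  have : Nontrivial W := Submodule.nontrivial_iff_ne_bot.mpr hW
  obtain ⟨c, hc⟩ := Module.End.exists_eigenvalue (T.P.restrict h.P_mem)
  obtain ⟨⟨x, hxW⟩, hx⟩ := hc.exists_hasEigenvector
  have hx0 : x ≠ 0 := fun h0 => hx.2 (Subtype.ext h0)
  have hPx : T.P x = c • x := congrArg Subtype.val hx.apply_eq_smul
  have hsymm := T.inner_P x x
  have hpos := T.inner_P_pos x hx0
  have hxx : (0 : ℝ) < ‖x‖ ^ 2 := by positivity
  rw [hPx, inner_smul_left, inner_smul_right, inner_self_eq_norm_sq_to_K] at hsymm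
  rw [hPx, inner_smul_right, inner_self_eq_norm_sq_to_K] at hpos
  have hc : ((c.re : ℝ) : ℂ) = c := by
    refine Complex.conj_eq_iff_re.mp (mul_right_cancel₀ ?_ hsymm)
    simpa using hx0
  have hcpos : 0 < c.re := by
    rw [← hc, Complex.re_ofReal_mul] at hpos
    refine pos_of_mul_pos_left (b := ‖x‖ ^ 2) ?_ hxx.le
    exact_mod_cast hpos
  refine ⟨((‖x‖⁻¹ : ℝ) : ℂ) • x, W.smul_mem _ hxW, c.re, hcpos, ?_, ?_⟩
  · rw [norm_smul, Complex.norm_real, norm_inv, norm_norm,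
      inv_mul_cancel₀ (norm_ne_zero_iff.mpr hx0)]
  · rw [map_smul, hPx, hc, smul_comm]

lemma Stable.exists_good_or_neutral [FiniteDimensional ℂ E] {W : Submodule ℂ E}
    (h : T.Stable W) (hW : W ≠ ⊥) :
    (∃ v ∈ W, ∃ a, T.Good a v) ∨ ∃ u ∈ W, T.Neutral u := by
  obtain ⟨x, hxW, l, hl, hx, hPx⟩ := h.exists_eigenvector hW
  rcases lt_trichotomy l 1 with h1 | h1 | h1
  · exact Or.inl ⟨T.J x, h.J_mem x hxW, _, good_of_one_lt ((one_lt_inv₀ hl).mpr h1)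
      (T.P_J hl.ne' hPx) (by rw [T.norm_J, hx])⟩
  · right
    subst h1
    have hPθ := T.P_θ hl.ne' hPx
    simp only [inv_one, Complex.ofReal_one, one_smul] at hPθ hPx
    by_cases h0 : x + T.θ x = 0
    · have hθ : T.θ x = -x := (neg_eq_of_add_eq_zero_right h0).symm
      have hx0 : x ≠ 0 := by
        rw [← norm_ne_zero_iff, hx]; exact one_ne_zero
      refine ⟨_, W.smul_mem _ (W.smul_mem Complex.I hxW), neutral_smul (y := Complex.I • x)
        (smul_ne_zero Complex.I_ne_zero hx0) ?_ ?_⟩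
      · rw [map_smulₛₗ, hθ, Complex.conj_I, neg_smul_neg]
      · rw [map_smul, hPx]
    · refine ⟨_, W.smul_mem _ (W.add_mem hxW (h.θ_mem x hxW)), neutral_smul h0 ?_ ?_⟩
      · rw [map_add, T.θ_θ, add_comm]
      · rw [map_add, hPx, hPθ]
  · exact Or.inl ⟨x, hxW, _, good_of_one_lt h1 hPx hx⟩

lemma Neutral.good {u w : E} (hu : T.Neutral u) (hw : T.Neutral w) (h : ⟪u, w⟫_ℂ = 0)
    (hJ : ⟪T.J u, w⟫_ℂ = 0) : T.Good 1 (((√2)⁻¹ : ℂ) • (u + Complex.I • w)) := by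
  have hc : (starRingEnd ℂ) ((√2)⁻¹ : ℂ) = ((√2)⁻¹ : ℂ) := by
    rw [map_inv₀, Complex.conj_ofReal]
  have huu : ⟪u, u⟫_ℂ = 1 := by rw [inner_self_eq_norm_sq_to_K, hu.norm_eq]; simp
  have hww : ⟪w, w⟫_ℂ = 1 := by rw [inner_self_eq_norm_sq_to_K, hw.norm_eq]; simp
  have h' : ⟪w, u⟫_ℂ = 0 := inner_eq_zero_symm.mp h
  have hJ' : ⟪w, T.J u⟫_ℂ = 0 := inner_eq_zero_symm.mp hJ
  have hJ2 : ⟪u, T.J w⟫_ℂ = 0 := by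
    rw [T.inner_J_left] at hJ
    exact neg_eq_zero.mp hJ
  have hs : ((√2)⁻¹ : ℂ) * ((√2)⁻¹ : ℂ) = 2⁻¹ := by
    rw [← mul_inv, ← Complex.ofReal_mul, Real.mul_self_sqrt zero_le_two, Complex.ofReal_ofNat]
  refine ⟨le_rfl, ?_, ?_, ?_, ?_⟩
  · simp [hu.P_eq, hw.P_eq]
  · rw [norm_eq_sqrt_re_inner (𝕜 := ℂ), Real.sqrt_eq_one]
    simp only [inner_smul_left, inner_smul_right, inner_add_left, inner_add_right, hc, h, h', huu,
      hww, Complex.conj_I]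
    have : ((√2)⁻¹ : ℂ) * (((√2)⁻¹ : ℂ) * (1 + -Complex.I * 0) +
        Complex.I * (((√2)⁻¹ : ℂ) * (0 + -Complex.I * 1))) = 1 := by
      linear_combination 2 * hs - ((√2)⁻¹ : ℂ) ^ 2 * Complex.I_sq
    rw [this, RCLike.one_re]
  · simp only [map_smulₛₗ, map_add, hu.θ_eq, hw.θ_eq, inner_smul_left, inner_smul_right,
      inner_add_left, inner_add_right, hc, h, h', huu, hww, Complex.conj_I]
    linear_combination ((√2)⁻¹ : ℂ) ^ 2 * Complex.I_sq
  · simp only [map_smul, map_add, inner_smul_left, inner_smul_right,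
      inner_add_left, inner_add_right, hJ', hJ2, hu.inner_J, hw.inner_J]
    norm_num

lemma Neutral.stable_span {u : E} (hu : T.Neutral u) :
    T.Stable (Submodule.span ℂ {u, T.J u}) := by
  have hu1 : u ∈ Submodule.span ℂ {u, T.J u} := Submodule.subset_span (by simp)
  have hu2 : T.J u ∈ Submodule.span ℂ {u, T.J u} := Submodule.subset_span (by simp)
  have hPJ : T.P (T.J u) = T.J u := by
    simpa [hu.P_eq] using T.P_J_P u
  apply Stable.span <;> rintro x (rfl | rfl)
  · exact hu2
  · rw [T.J_J]; exact Submodule.neg_mem _ hu1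
  · rwa [hu.θ_eq]
  · rwa [T.θ_J, hu.θ_eq]
  · rwa [hu.P_eq]
  · rwa [hPJ]

lemma Stable.exists_good [FiniteDimensional ℂ E] {W : Submodule ℂ E}
    (h : T.Stable W) (hW : 2 < Module.finrank ℂ W) : ∃ v ∈ W, ∃ a, T.Good a v := by
  have hW0 : W ≠ ⊥ := by
    rintro rfl
    simp at hW
  rcases h.exists_good_or_neutral hW0 with hg | ⟨u, huW, hu⟩
  · exact hg
  have hle : Submodule.span ℂ {u, T.J u} ≤ W := by
    rw [Submodule.span_le]
    rintro x (rfl | rfl)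
    · exact huW
    · exact h.J_mem _ huW
  have hcard : Module.finrank ℂ (Submodule.span ℂ {u, T.J u}) ≤ 2 := by
    classical
    refine le_trans ?_ (Finset.card_le_two (a := u) (b := T.J u))
    have := finrank_span_finset_le_card (R := ℂ) ({u, T.J u} : Finset E)
    rwa [Finset.coe_pair] at this
  have hsum := Submodule.finrank_add_inf_finrank_orthogonal hle
  have hne : (Submodule.span ℂ {u, T.J u})ᗮ ⊓ W ≠ ⊥ := by
    intro h0
    rw [h0, finrank_bot] at hsum
    omega
  rcases (hu.stable_span.orthogonal.inf h).exists_good_or_neutral hne with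
    ⟨v, hv, hg⟩ | ⟨w, hw, hwn⟩
  · exact ⟨v, hv.2, hg⟩
  · have hort := (Submodule.mem_orthogonal _ _).mp hw.1
    exact ⟨_, W.smul_mem _ (W.add_mem huW (W.smul_mem _ hw.2)), 1, hu.good hwn
      (hort _ (Submodule.subset_span (by simp))) (hort _ (Submodule.subset_span (by simp)))⟩

variable (T)

/-- The vectors `v`, `θ v`, `J v`, `J (θ v)`. -/
def orbit (v : E) : Bool × Bool → E
  | (false, false) => v
  | (false, true) => T.θ v
  | (true, false) => T.J v
  | (true, true) => T.J (T.θ v)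

/-- Good vectors whose orbits are mutually orthogonal. -/
structure Frame {ι : Type*} (a : ι → ℝ) (v : ι → E) : Prop where
  good : ∀ i, T.Good (a i) (v i)
  inner_orbit : ∀ i j, i ≠ j → ∀ b, ⟪v i, T.orbit (v j) b⟫_ℂ = 0

variable {T}

lemma inner_orbit_orbit (x y : E) (b c : Bool × Bool) :
    ⟪T.orbit x b, T.orbit y c⟫_ℂ = 0 ↔
      ⟪x, T.orbit y (xor b.1 c.1, xor b.2 c.2)⟫_ℂ = 0 := by
  have hθ : ∀ z w, ⟪T.θ z, w⟫_ℂ = 0 ↔ ⟪z, T.θ w⟫_ℂ = 0 := fun z w => by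
    rw [T.inner_θ_left, inner_eq_zero_symm]
  rcases b with ⟨_ | _, _ | _⟩ <;> rcases c with ⟨_ | _, _ | _⟩ <;>
    simp [orbit, T.inner_J_left, hθ, T.θ_J, T.θ_θ, T.J_J]

lemma norm_orbit (x : E) (b : Bool × Bool) : ‖T.orbit x b‖ = ‖x‖ := by
  have hθ : ‖T.θ x‖ = ‖x‖ := by
    rw [norm_eq_sqrt_re_inner (𝕜 := ℂ), T.inner_θ_θ, ← norm_eq_sqrt_re_inner]
  rcases b with ⟨_ | _, _ | _⟩ <;> simp [orbit, T.norm_J, hθ]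

lemma Good.inner_orbit {a : ℝ} {v : E} (h : T.Good a v) {b : Bool × Bool}
    (hb : b ≠ (false, false)) : ⟪v, T.orbit v b⟫_ℂ = 0 := by
  rcases b with ⟨_ | _, _ | _⟩
  · exact absurd rfl hb
  · exact h.inner_θ
  · exact h.inner_J
  · exact T.inner_J_θ_self v

lemma Frame.orthonormal {ι : Type*} {a : ι → ℝ} {v : ι → E} (h : T.Frame a v) :
    Orthonormal ℂ (fun p : ι × Bool × Bool => T.orbit (v p.1) p.2) := by
  refine ⟨fun p => by rw [norm_orbit, (h.good _).norm_eq], ?_⟩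
  rintro ⟨i, b⟩ ⟨j, c⟩ hne
  simp only [inner_orbit_orbit]
  by_cases hij : i = j
  · subst hij
    refine (h.good i).inner_orbit fun hb => hne ?_
    simp only [Prod.mk.injEq, bne_eq_false_iff_eq, Bool.bne_eq_xor.symm] at hb
    exact congrArg (Prod.mk i) (Prod.ext hb.1 hb.2)
  · exact h.inner_orbit i j hij _

lemma Frame.four_mul_card_le [FiniteDimensional ℂ E] {k : ℕ} {a : Fin k → ℝ} {v : Fin k → E}
    (h : T.Frame a v) : 4 * k ≤ Module.finrank ℂ E := by
  have := h.orthonormal.linearIndependent.fintype_card_le_finrank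
  simpa [mul_comm] using this

variable (T) in
/-- The span of the orbits of a family of vectors. -/
def orbitSpan {ι : Type*} (v : ι → E) : Submodule ℂ E :=
  Submodule.span ℂ (Set.range fun p : ι × Bool × Bool => T.orbit (v p.1) p.2)

lemma orbit_mem_orbitSpan {ι : Type*} (v : ι → E) (i : ι) (b : Bool × Bool) :
    T.orbit (v i) b ∈ T.orbitSpan v :=
  Submodule.subset_span ⟨(i, b), rfl⟩

lemma Frame.stable_orbitSpan {ι : Type*} {a : ι → ℝ} {v : ι → E} (h : T.Frame a v) :
    T.Stable (T.orbitSpan v) := by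
  have hm := orbit_mem_orbitSpan (T := T) v
  apply Stable.span <;> rintro _ ⟨⟨i, b⟩, rfl⟩
  · change T.J (T.orbit (v i) b) ∈ T.orbitSpan v
    rcases b with ⟨_ | _, _ | _⟩
    · exact hm i (true, false)
    · exact hm i (true, true)
    · exact (T.J_J (v i)).symm ▸ Submodule.neg_mem _ (hm i (false, false))
    · exact (T.J_J (T.θ (v i))).symm ▸ Submodule.neg_mem _ (hm i (false, true))
  · change T.θ (T.orbit (v i) b) ∈ T.orbitSpan v
    have hb : T.θ (T.orbit (v i) b) = T.orbit (v i) (b.1, !b.2) := by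
      rcases b with ⟨_ | _, _ | _⟩ <;> simp [orbit, T.θ_J, T.θ_θ]
    exact hb ▸ hm i _
  · have hl : a i ^ 2 ≠ 0 := pow_ne_zero 2 (zero_lt_one.trans_le (h.good i).one_le).ne'
    have hP := (h.good i).P_eq
    have hθ := T.P_θ hl hP
    rcases b with ⟨_ | _, _ | _⟩
    · exact hP ▸ Submodule.smul_mem _ _ (hm i (false, false))
    · exact hθ ▸ Submodule.smul_mem _ _ (hm i (false, true))
    · exact T.P_J hl hP ▸ Submodule.smul_mem _ _ (hm i (true, false))
    · exact T.P_J (inv_ne_zero hl) hθ ▸ Submodule.smul_mem _ _ (hm i (true, true))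

lemma inner_orbit_of_mem_orthogonal {ι : Type*} {v : ι → E} {x : E}
    (hx : x ∈ (T.orbitSpan v)ᗮ) (i : ι) (b : Bool × Bool) : ⟪x, T.orbit (v i) b⟫_ℂ = 0 :=
  (Submodule.mem_orthogonal' _ _).mp hx _ (orbit_mem_orbitSpan v i b)

lemma Frame.cons {k : ℕ} {a : Fin k → ℝ} {v : Fin k → E} (h : T.Frame a v) {x : E} {c : ℝ}
    (hx : x ∈ (T.orbitSpan v)ᗮ) (hg : T.Good c x) :
    T.Frame (Fin.cons c a : Fin (k + 1) → ℝ) (Fin.cons x v : Fin (k + 1) → E) := by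
  refine ⟨fun i => ?_, fun i j hij b => ?_⟩
  · induction i using Fin.cases with
    | zero => exact hg
    | succ i => exact h.good i
  · induction i using Fin.cases with
    | zero =>
      induction j using Fin.cases with
      | zero => exact absurd rfl hij
      | succ j => exact inner_orbit_of_mem_orthogonal hx j b
    | succ i =>
      induction j using Fin.cases with
      | zero =>
        have h0 := (inner_orbit_orbit (T := T) x (v i) b (false, false)).mpr
          (inner_orbit_of_mem_orthogonal hx i _)
        exact inner_eq_zero_symm.mp h0
      | succ j => exact h.inner_orbit i j (fun e => hij (e ▸ rfl)) b

lemma finrank_orbitSpan_le [FiniteDimensional ℂ E] {k : ℕ} (v : Fin k → E) :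
    Module.finrank ℂ (T.orbitSpan v) ≤ 4 * k := by
  refine (finrank_range_le_card _).trans ?_
  simp [mul_comm]

lemma exists_frame [FiniteDimensional ℂ E] (k : ℕ) (hk : 4 * k ≤ Module.finrank ℂ E) :
    ∃ (a : Fin k → ℝ) (v : Fin k → E), T.Frame a v := by
  induction k with
  | zero => exact ⟨Fin.elim0, Fin.elim0, fun i => i.elim0, fun i => i.elim0⟩
  | succ k ih =>
    obtain ⟨a, v, h⟩ := ih (by omega)
    have h1 := finrank_orbitSpan_le (T := T) v
    have h2 := (T.orbitSpan v).finrank_add_finrank_orthogonal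
    obtain ⟨x, hx, c, hg⟩ := h.stable_orbitSpan.orthogonal.exists_good (by omega)
    exact ⟨_, _, h.cons hx hg⟩

lemma Frame.comp {ι κ : Type*} {a : ι → ℝ} {v : ι → E} (h : T.Frame a v) {f : κ → ι}
    (hf : Function.Injective f) : T.Frame (a ∘ f) (v ∘ f) :=
  ⟨fun i => h.good (f i), fun _ _ hij => h.inner_orbit _ _ (hf.ne hij)⟩

lemma exists_antitone_frame [FiniteDimensional ℂ E] (k : ℕ) (hk : 4 * k ≤ Module.finrank ℂ E) :
    ∃ (a : Fin k → ℝ) (v : Fin k → E), Antitone a ∧ T.Frame a v := by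
  obtain ⟨a, v, h⟩ := exists_frame (T := T) k hk
  refine ⟨_, _, ?_, h.comp ((Tuple.sort a).injective.comp Fin.rev_injective)⟩
  exact fun _ _ hij => Tuple.monotone_sort a (Fin.rev_le_rev.mpr hij)

lemma Frame.exists_neutral [FiniteDimensional ℂ E] {k : ℕ} {a : Fin k → ℝ} {v : Fin k → E}
    (h : T.Frame a v) (h1 : 4 * k < Module.finrank ℂ E)
    (h2 : Module.finrank ℂ E < 4 * (k + 1)) : ∃ u ∈ (T.orbitSpan v)ᗮ, T.Neutral u := by
  have h3 := finrank_orbitSpan_le (T := T) v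
  have h4 := (T.orbitSpan v).finrank_add_finrank_orthogonal
  have hne : (T.orbitSpan v)ᗮ ≠ ⊥ := by
    intro h0
    rw [h0, finrank_bot] at h4
    omega
  rcases h.stable_orbitSpan.orthogonal.exists_good_or_neutral hne with ⟨x, hx, c, hg⟩ | hu
  · exact absurd (h.cons hx hg).four_mul_card_le (by omega)
  · exact hu

lemma exists_adapted [FiniteDimensional ℂ E] (L : ℕ) (hE : Module.finrank ℂ E = 2 * L) :
    ∃ (a : Fin (L / 2) → ℝ) (c : Fin L → E), Antitone a ∧ (∀ i, 1 ≤ a i) ∧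
      (∀ i j, ⟪c i, c j⟫_ℂ = if i = j then 1 else 0) ∧ (∀ i j, ⟪c i, T.J (c j)⟫_ℂ = 0) ∧
      (∀ i j : Fin L, (j : ℕ) = permIdx L i → T.θ (c i) = c j) ∧
      ∀ i, T.P (c i) = ((dvec L a i ^ 2 : ℝ) : ℂ) • c i := by
  obtain ⟨a, v, ha, h⟩ := exists_antitone_frame (T := T) (L / 2) (by omega)
  obtain ⟨u, hu, hθu, hPu, hnu⟩ : ∃ u ∈ (T.orbitSpan v)ᗮ, T.θ u = u ∧ T.P u = u ∧
      (L / 2 < L - L / 2 → ⟪u, u⟫_ℂ = 1) := by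
    by_cases hL : L / 2 < L - L / 2
    · obtain ⟨u, hu, hn⟩ := h.exists_neutral (by omega) (by omega)
      exact ⟨u, hu, hn.θ_eq, hn.P_eq, fun _ => by
        rw [inner_self_eq_norm_sq_to_K, hn.norm_eq]; simp⟩
    · exact ⟨0, Submodule.zero_mem _, map_zero _, map_zero _, fun h' => absurd h' hL⟩
  have huu : ⟪u, T.J u⟫_ℂ = 0 := by
    have := T.inner_J_θ_self u
    rwa [hθu] at this
  classical
  have hvv := orthonormal_iff_ite.mp h.orthonormal
  have h1 : ∀ i j, ⟪v i, v j⟫_ℂ = if i = j then 1 else 0 := fun i j => by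
    simpa [orbit] using hvv (i, false, false) (j, false, false)
  have h2 : ∀ i j, ⟪v i, T.θ (v j)⟫_ℂ = 0 := fun i j => by
    simpa [orbit] using hvv (i, false, false) (j, false, true)
  have h3 : ∀ i j, ⟪T.θ (v i), v j⟫_ℂ = 0 := fun i j => by
    simpa [orbit] using hvv (i, false, true) (j, false, false)
  have h4 : ∀ i j, ⟪T.θ (v i), T.θ (v j)⟫_ℂ = if i = j then 1 else 0 := fun i j => by
    simpa [orbit] using hvv (i, false, true) (j, false, true)
  have h5 : ∀ i j, ⟪v i, T.J (v j)⟫_ℂ = 0 := fun i j => by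
    simpa [orbit] using hvv (i, false, false) (j, true, false)
  have h6 : ∀ i j, ⟪v i, T.J (T.θ (v j))⟫_ℂ = 0 := fun i j => by
    simpa [orbit] using hvv (i, false, false) (j, true, true)
  have h7 : ∀ i j, ⟪T.θ (v i), T.J (v j)⟫_ℂ = 0 := fun i j => by
    simpa [orbit] using hvv (i, false, true) (j, true, false)
  have h8 : ∀ i j, ⟪T.θ (v i), T.J (T.θ (v j))⟫_ℂ = 0 := fun i j => by
    simpa [orbit] using hvv (i, false, true) (j, true, true)
  have hu1 : ∀ i, ⟪u, v i⟫_ℂ = 0 := fun i =>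
    inner_orbit_of_mem_orthogonal hu i (false, false)
  have hu2 : ∀ i, ⟪u, T.θ (v i)⟫_ℂ = 0 := fun i =>
    inner_orbit_of_mem_orthogonal hu i (false, true)
  have hu3 : ∀ i, ⟪u, T.J (v i)⟫_ℂ = 0 := fun i =>
    inner_orbit_of_mem_orthogonal hu i (true, false)
  have hu4 : ∀ i, ⟪u, T.J (T.θ (v i))⟫_ℂ = 0 := fun i =>
    inner_orbit_of_mem_orthogonal hu i (true, true)
  have hu1' : ∀ i, ⟪v i, u⟫_ℂ = 0 := fun i => inner_eq_zero_symm.mp (hu1 i)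
  have hu2' : ∀ i, ⟪T.θ (v i), u⟫_ℂ = 0 := fun i => inner_eq_zero_symm.mp (hu2 i)
  have hu3' : ∀ i, ⟪v i, T.J u⟫_ℂ = 0 := fun i => by
    rw [← inner_eq_zero_symm, T.inner_J_left, hu3, neg_zero]
  have hu4' : ∀ i, ⟪T.θ (v i), T.J u⟫_ℂ = 0 := fun i => by
    rw [← inner_eq_zero_symm, T.inner_J_left, hu4, neg_zero]
  refine ⟨a, fun i => if h : (i : ℕ) < L / 2 then v ⟨i, h⟩
    else if h2 : L - L / 2 ≤ (i : ℕ) then T.θ (v ⟨(i : ℕ) - (L - L / 2), by omega⟩)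
    else u, ha, fun i => (h.good i).one_le, fun i j => ?_, fun i j => ?_, fun i j hij => ?_,
    fun i => ?_⟩
  · have hi := i.isLt
    have hj := j.isLt
    dsimp only
    split_ifs <;> try simp only [h1, h2, h3, h4, hu1, hu2, hu1', hu2']
    all_goals
      first
      | (apply hnu; omega)
      | grind
  · dsimp only
    split_ifs <;> simp only [h5, h6, h7, h8, hu3, hu4, hu3', hu4', huu]
  · have hi := i.isLt
    have hj := j.isLt
    dsimp only
    unfold permIdx at hij
    split_ifs at hij ⊢ <;> first
      | omega
      | exact hθu
      | simp only [T.θ_θ, hij, Nat.add_sub_cancel]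
  · unfold dvec
    have hl : ∀ k, a k ^ 2 ≠ 0 := fun k =>
      pow_ne_zero 2 (zero_lt_one.trans_le (h.good k).one_le).ne'
    dsimp only
    split_ifs
    · exact (h.good _).P_eq
    · rw [inv_pow]
      exact T.P_θ (hl _) (h.good _).P_eq
    · rw [hPu]; simp

end PolarTriple

section MatrixIdentities

variable (L : ℕ)

lemma permIdx_lt {i : ℕ} (hi : i < L) : permIdx L i < L := by
  unfold permIdx; split_ifs <;> omega

lemma permIdx_permIdx {i : ℕ} (hi : i < L) : permIdx L (permIdx L i) = i := by
  unfold permIdx; split_ifs <;> omega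

/-- The index involution underlying `Rmat`. -/
def permFin (i : Fin L) : Fin L := ⟨permIdx L i, permIdx_lt L i.isLt⟩

lemma permFin_permFin (i : Fin L) : permFin L (permFin L i) = i :=
  Fin.ext (permIdx_permIdx L i.isLt)

lemma Rmat_apply (i j : Fin L) : Rmat L i j = if j = permFin L i then 1 else 0 := by
  simp [Rmat, permFin, Fin.ext_iff]

lemma Rmat_transpose : (Rmat L)ᵀ = Rmat L := by
  ext i j
  rw [transpose_apply, Rmat_apply, Rmat_apply]
  congr 1
  rw [eq_iff_iff]
  constructor <;> rintro rfl <;> rw [permFin_permFin]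

lemma Rmat_conjTranspose : (Rmat L)ᴴ = Rmat L := by
  rw [conjTranspose, Rmat_transpose]
  ext i j
  rw [map_apply, Rmat_apply]
  split_ifs <;> simp

lemma mul_Rmat_apply {m : Type*} (X : Matrix m (Fin L) ℂ) (i : m) (j : Fin L) :
    (X * Rmat L) i j = X i (permFin L j) := by
  rw [mul_apply, ← Rmat_transpose]
  simp [Rmat_apply]

lemma Rmat_mul_Rmat : Rmat L * Rmat L = 1 := by
  ext i j
  rw [mul_Rmat_apply, Rmat_apply, one_apply]
  congr 1
  rw [eq_iff_iff]
  constructor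
  · intro h
    rw [← permFin_permFin L j, h, permFin_permFin]
  · rintro rfl
    rfl

lemma Smat_mul_Smat : Smat L * Smat L = 1 := by
  simp [Smat, fromBlocks_multiply, Rmat_mul_Rmat]

lemma Smat_transpose : (Smat L)ᵀ = Smat L := by
  simp [Smat, fromBlocks_transpose, Rmat_transpose]

lemma Smat_conjTranspose : (Smat L)ᴴ = Smat L := by
  simp [Smat, fromBlocks_conjTranspose, Rmat_conjTranspose]

lemma Jmat_mul_Jmat : Jmat L * Jmat L = -1 := by
  simp [Jmat, fromBlocks_multiply, ← fromBlocks_one, fromBlocks_neg]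

lemma Jmat_transpose : (Jmat L)ᵀ = -Jmat L := by
  simp [Jmat, fromBlocks_transpose, fromBlocks_neg]

lemma Jmat_conjTranspose : (Jmat L)ᴴ = -Jmat L := by
  simp [Jmat, fromBlocks_conjTranspose, fromBlocks_neg]

lemma Smat_mul_Jmat : Smat L * Jmat L = Jmat L * Smat L := by
  simp [Smat, Jmat, fromBlocks_multiply]

variable {L}

lemma Gset_mul {M N : Matrix (Fin L ⊕ Fin L) (Fin L ⊕ Fin L) ℂ} (hM : M ∈ Gset L)
    (hN : N ∈ Gset L) : M * N ∈ Gset L := by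
  constructor
  · calc (M * N)ᴴ * Jmat L * (M * N) = Nᴴ * (Mᴴ * Jmat L * M) * N := by
          rw [conjTranspose_mul]; simp only [Matrix.mul_assoc]
      _ = Jmat L := by rw [hM.1, hN.1]
  · calc (M * N)ᵀ * Smat L * (M * N) = Nᵀ * (Mᵀ * Smat L * M) * N := by
          rw [transpose_mul]; simp only [Matrix.mul_assoc]
      _ = Smat L := by rw [hM.2, hN.2]

lemma Gset_of_mul_eq_one {M N : Matrix (Fin L ⊕ Fin L) (Fin L ⊕ Fin L) ℂ} (hM : M ∈ Gset L)
    (h : M * N = 1) : N ∈ Gset L := by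
  constructor
  · calc Nᴴ * Jmat L * N = (M * N)ᴴ * Jmat L * (M * N) := by
          nth_rw 1 [← hM.1]; rw [conjTranspose_mul]; simp only [Matrix.mul_assoc]
      _ = Jmat L := by simp [h]
  · calc Nᵀ * Smat L * N = (M * N)ᵀ * Smat L * (M * N) := by
          nth_rw 1 [← hM.2]; rw [transpose_mul]; simp only [Matrix.mul_assoc]
      _ = Smat L := by simp [h]

lemma mul_Jmat_mul_conjTranspose {M : Matrix (Fin L ⊕ Fin L) (Fin L ⊕ Fin L) ℂ}
    (hM : M ∈ Gset L) : M * Jmat L * Mᴴ = Jmat L := by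
  have h1 : (-Jmat L * Mᴴ * Jmat L) * M = 1 := by
    rw [Matrix.mul_assoc, Matrix.mul_assoc, ← Matrix.mul_assoc Mᴴ, hM.1, Matrix.neg_mul,
      Jmat_mul_Jmat, neg_neg]
  have h2 := mul_eq_one_comm.mp h1
  calc M * Jmat L * Mᴴ = M * (-Jmat L * Mᴴ * Jmat L) * Jmat L := by
        simp only [Matrix.mul_assoc, Jmat_mul_Jmat, Matrix.mul_neg, Matrix.neg_mul,
          Matrix.mul_one, neg_neg]
    _ = Jmat L := by rw [h2, Matrix.one_mul]

lemma mul_Smat_mul_transpose {M : Matrix (Fin L ⊕ Fin L) (Fin L ⊕ Fin L) ℂ}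
    (hM : M ∈ Gset L) : M * Smat L * Mᵀ = Smat L := by
  have h1 : (Smat L * Mᵀ * Smat L) * M = 1 := by
    rw [Matrix.mul_assoc, Matrix.mul_assoc, ← Matrix.mul_assoc Mᵀ, hM.2, Smat_mul_Smat]
  have h2 := mul_eq_one_comm.mp h1
  calc M * Smat L * Mᵀ = M * (Smat L * Mᵀ * Smat L) * Smat L := by
        simp only [Matrix.mul_assoc, Smat_mul_Smat, Matrix.mul_one]
    _ = Smat L := by rw [h2, Matrix.one_mul]

lemma gram_mul_Jmat_mul_gram {M : Matrix (Fin L ⊕ Fin L) (Fin L ⊕ Fin L) ℂ}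
    (hM : M ∈ Gset L) : Mᴴ * M * Jmat L * (Mᴴ * M) = Jmat L := by
  calc Mᴴ * M * Jmat L * (Mᴴ * M) = Mᴴ * (M * Jmat L * Mᴴ) * M := by
        simp only [Matrix.mul_assoc]
    _ = Jmat L := by rw [mul_Jmat_mul_conjTranspose hM, hM.1]

lemma gram_mul_Smat_mul_gram {M : Matrix (Fin L ⊕ Fin L) (Fin L ⊕ Fin L) ℂ}
    (hM : M ∈ Gset L) : Mᴴ * M * Smat L * (Mᴴ * M)ᵀ = Smat L := by
  have h := congrArg (fun X => Xᴴᵀ) hM.2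
  simp only [conjTranspose_mul, transpose_mul, Smat_conjTranspose, Smat_transpose] at h
  rw [show Mᵀᴴᵀ = Mᴴ from rfl] at h
  calc Mᴴ * M * Smat L * (Mᴴ * M)ᵀ = Mᴴ * (M * Smat L * Mᵀ) * Mᴴᵀ := by
        rw [transpose_mul]; simp only [Matrix.mul_assoc]
    _ = Smat L := by
        rw [mul_Smat_mul_transpose hM]
        exact h

lemma det_fromBlocks_complex (A C : Matrix (Fin L) (Fin L) ℂ) :
    (fromBlocks A (-C) C A).det = (A + Complex.I • C).det * (A - Complex.I • C).det := by
  have h : fromBlocks 1 (Complex.I • (1 : Matrix (Fin L) (Fin L) ℂ)) 0 1 *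
      fromBlocks A (-C) C A * fromBlocks 1 (-(Complex.I • (1 : Matrix (Fin L) (Fin L) ℂ))) 0 1 =
      fromBlocks (A + Complex.I • C) 0 C (A - Complex.I • C) := by
    simp only [fromBlocks_multiply]
    congr 1 <;> simp [smul_smul]
    abel
    abel
  have h' := congrArg det h
  simpa using h'

lemma det_eq_one_of_mem_Gset {K : Matrix (Fin L ⊕ Fin L) (Fin L ⊕ Fin L) ℂ} (hK : K ∈ Gset L)
    (hu : Kᴴ * K = 1) : K.det = 1 := by
  have hu' : K * Kᴴ = 1 := mul_eq_one_comm.mp hu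
  have hJ : Jmat L * K = K * Jmat L := by
    calc Jmat L * K = K * Kᴴ * Jmat L * K := by rw [hu', Matrix.one_mul]
      _ = K * (Kᴴ * Jmat L * K) := by simp only [Matrix.mul_assoc]
      _ = K * Jmat L := by rw [hK.1]
  have hS : Smat L * K = Kᴴᵀ * Smat L := by
    have : Kᴴᵀ * Kᵀ = 1 := by rw [← transpose_mul, hu', transpose_one]
    calc Smat L * K = Kᴴᵀ * Kᵀ * Smat L * K := by rw [this, Matrix.one_mul]
      _ = Kᴴᵀ * (Kᵀ * Smat L * K) := by simp only [Matrix.mul_assoc]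
      _ = Kᴴᵀ * Smat L := by rw [hK.2]
  rw [← fromBlocks_toBlocks K] at hJ hS
  simp only [Jmat, Smat, fromBlocks_multiply, fromBlocks_inj, fromBlocks_conjTranspose,
    fromBlocks_transpose] at hJ hS
  simp only [Matrix.zero_mul, Matrix.mul_zero, zero_add, add_zero, Matrix.one_mul, Matrix.mul_one,
    Matrix.neg_mul, Matrix.mul_neg] at hJ hS
  obtain ⟨hJ1, hJ2, -, -⟩ := hJ
  obtain ⟨hA, -, hC, -⟩ := hS
  set A := K.toBlocks₁₁
  set C := K.toBlocks₂₁
  have hdet : K.det = (A + Complex.I • C).det * (A - Complex.I • C).det := by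
    rw [← det_fromBlocks_complex, ← fromBlocks_toBlocks K, ← hJ1, neg_inj.mp hJ2]
  have hconj : Rmat L * (A + Complex.I • C) = (A - Complex.I • C)ᴴᵀ * Rmat L := by
    rw [Matrix.mul_add, Matrix.mul_smul, hA, hC]
    simp [Matrix.add_mul]
  have hR : (Rmat L).det ≠ 0 := by
    intro h0
    have := congrArg det (Rmat_mul_Rmat L)
    simp [h0] at this
  have hd := congrArg det hconj
  rw [det_mul, det_mul, mul_comm] at hd
  have hd' := mul_right_cancel₀ hR hd
  rw [det_transpose, det_conjTranspose] at hd'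
  rw [hd', ← starRingEnd_apply, ← Complex.normSq_eq_conj_mul_self] at hdet
  have h1 := congrArg det hu
  rw [det_mul, det_conjTranspose, det_one, hdet, ← starRingEnd_apply, Complex.conj_ofReal] at h1
  have h2 : Complex.normSq (A - Complex.I • C).det * Complex.normSq (A - Complex.I • C).det = 1 :=
    by exact_mod_cast h1
  rw [hdet]
  have := Complex.normSq_nonneg (A - Complex.I • C).det
  have h3 : Complex.normSq (A - Complex.I • C).det = 1 := by nlinarith
  rw [h3, Complex.ofReal_one]

end MatrixIdentities

section Dmat

variable {L : ℕ}

lemma dvec_mul_dvec_permFin {a : Fin (L / 2) → ℝ} (ha : ∀ i, a i ≠ 0) (i : Fin L) :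
    dvec L a i * dvec L a (permFin L i) = 1 := by
  have hi := i.isLt
  unfold dvec permFin permIdx
  dsimp only
  split_ifs <;> first | omega | simp [ha]

lemma dvec_ne_zero {a : Fin (L / 2) → ℝ} (ha : ∀ i, a i ≠ 0) (i : Fin L) : dvec L a i ≠ 0 :=
  left_ne_zero_of_mul_eq_one (dvec_mul_dvec_permFin ha i)

lemma Dmat_conjTranspose (a : Fin (L / 2) → ℝ) : (Dmat L a)ᴴ = Dmat L a := by
  simp only [Dmat, fromBlocks_conjTranspose, diagonal_conjTranspose, conjTranspose_zero]
  congr 2 <;> ext i <;> simp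

lemma Dmat_mem_Gset {a : Fin (L / 2) → ℝ} (ha : ∀ i, a i ≠ 0) : Dmat L a ∈ Gset L := by
  have h0 : ∀ i, (dvec L a i : ℂ) ≠ 0 := fun i => by exact_mod_cast dvec_ne_zero ha i
  have h1 : ∀ i, (dvec L a i : ℂ) * dvec L a (permFin L i) = 1 := fun i => by
    exact_mod_cast dvec_mul_dvec_permFin ha i
  constructor
  · rw [Dmat_conjTranspose]
    simp only [Dmat, Jmat, fromBlocks_multiply]
    congr 1 <;> simp [h0, -diagonal_neg]
  · simp only [Dmat, Smat, fromBlocks_multiply, fromBlocks_transpose, diagonal_transpose]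
    congr 1 <;> simp
    · ext i j
      rw [mul_diagonal, diagonal_mul, Rmat_apply]
      split_ifs with h
      · rw [h, mul_one, h1]
      · simp
    · ext i j
      rw [mul_diagonal, diagonal_mul, Rmat_apply]
      split_ifs with h
      · rw [h, mul_one, ← mul_inv, h1, inv_one]
      · simp

lemma Dmat_mul_Dmat_inv {a : Fin (L / 2) → ℝ} (ha : ∀ i, a i ≠ 0) :
    Dmat L a * Dmat L (fun i => (a i)⁻¹) = 1 := by
  have h0 : ∀ i, (dvec L a i : ℂ) ≠ 0 := fun i => by exact_mod_cast dvec_ne_zero ha i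
  have h1 : ∀ i, dvec L (fun i => (a i)⁻¹) i = (dvec L a i)⁻¹ := fun i => by
    unfold dvec; split_ifs <;> simp
  simp only [Dmat, fromBlocks_multiply, ← fromBlocks_one]
  congr 1 <;> simp [h0, h1]

end Dmat

section Diagonalization

variable {L : ℕ}

lemma star_mulVec_eq {m n : Type*} [Fintype n] (A : Matrix m n ℂ) (x : n → ℂ) :
    star (A *ᵥ x) = Aᴴᵀ *ᵥ star x := by
  rw [star_mulVec, mulVec_transpose]

lemma inner_mulVec_mulVec {n : Type*} [Fintype n] (A B : Matrix n n ℂ) (x y : n → ℂ) :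
    ⟪WithLp.toLp 2 (A *ᵥ x), WithLp.toLp 2 (B *ᵥ y)⟫_ℂ = star x ⬝ᵥ ((Aᴴ * B) *ᵥ y) := by
  rw [EuclideanSpace.inner_eq_star_dotProduct, dotProduct_comm, star_mulVec, ← dotProduct_mulVec,
    mulVec_mulVec]

lemma inner_eq_dotProduct {n : Type*} [Fintype n] (x y : EuclideanSpace ℂ n) :
    ⟪x, y⟫_ℂ = star x.ofLp ⬝ᵥ y.ofLp := by
  rw [EuclideanSpace.inner_eq_star_dotProduct, dotProduct_comm]

/-- The structure on `ℂ^{2L}` given by `J`, `v ↦ S v̄` and `Mᴴ M`. -/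
def gramTriple {M : Matrix (Fin L ⊕ Fin L) (Fin L ⊕ Fin L) ℂ} (hM : M ∈ Gset L) :
    PolarTriple (EuclideanSpace ℂ (Fin L ⊕ Fin L)) where
  J := (Jmat L).toEuclideanLin
  θ :=
    { toFun := fun x => WithLp.toLp 2 (Smat L *ᵥ star x.ofLp)
      map_add' := fun x y => by simp [mulVec_add]
      map_smul' := fun c x => by simp [mulVec_smul] }
  P := (Mᴴ * M).toEuclideanLin
  J_J x := by
    change WithLp.toLp 2 (Jmat L *ᵥ (Jmat L *ᵥ x.ofLp)) = -x
    rw [mulVec_mulVec, Jmat_mul_Jmat, neg_mulVec, one_mulVec]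
    rfl
  θ_θ x := by
    change WithLp.toLp 2 (Smat L *ᵥ star (Smat L *ᵥ star x.ofLp)) = x
    rw [star_mulVec_eq, star_star, mulVec_mulVec, Smat_conjTranspose, Smat_transpose,
      Smat_mul_Smat, one_mulVec]
  θ_J x := by
    change WithLp.toLp 2 (Smat L *ᵥ star (Jmat L *ᵥ x.ofLp)) =
      WithLp.toLp 2 (Jmat L *ᵥ (Smat L *ᵥ star x.ofLp))
    rw [star_mulVec_eq, mulVec_mulVec, mulVec_mulVec, Jmat_conjTranspose, transpose_neg,
      Jmat_transpose, neg_neg, Smat_mul_Jmat]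
  inner_J_J x y := by
    change ⟪WithLp.toLp 2 (Jmat L *ᵥ x.ofLp), WithLp.toLp 2 (Jmat L *ᵥ y.ofLp)⟫_ℂ = _
    rw [inner_mulVec_mulVec, Jmat_conjTranspose, Matrix.neg_mul, Jmat_mul_Jmat, neg_neg,
      one_mulVec, inner_eq_dotProduct]
  inner_θ_θ x y := by
    change ⟪WithLp.toLp 2 (Smat L *ᵥ star x.ofLp), WithLp.toLp 2 (Smat L *ᵥ star y.ofLp)⟫_ℂ = _
    rw [inner_mulVec_mulVec, Smat_conjTranspose, Smat_mul_Smat, one_mulVec, star_star,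
      EuclideanSpace.inner_eq_star_dotProduct]
  inner_P x y := by
    change ⟪WithLp.toLp 2 ((Mᴴ * M) *ᵥ x.ofLp), y⟫_ℂ = ⟪x, WithLp.toLp 2 ((Mᴴ * M) *ᵥ y.ofLp)⟫_ℂ
    rw [inner_eq_dotProduct, inner_eq_dotProduct, star_mulVec, ← dotProduct_mulVec,
      conjTranspose_mul, conjTranspose_conjTranspose]
  inner_P_pos x hx := by
    change 0 < (⟪x, WithLp.toLp 2 ((Mᴴ * M) *ᵥ x.ofLp)⟫_ℂ).re
    have hMx : M *ᵥ x.ofLp ≠ 0 := by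
      intro h0
      have h1 : (Mᴴ * M * Jmat L * (Mᴴ * M)) *ᵥ x.ofLp = 0 := by
        rw [← Matrix.mul_assoc, ← mulVec_mulVec, h0, mulVec_zero]
      rw [gram_mul_Jmat_mul_gram hM] at h1
      have h2 : Jmat L *ᵥ (Jmat L *ᵥ x.ofLp) = 0 := by rw [h1, mulVec_zero]
      rw [mulVec_mulVec, Jmat_mul_Jmat, neg_mulVec, one_mulVec, neg_eq_zero] at h2
      exact hx (WithLp.ofLp_injective 2 h2)
    rw [inner_eq_dotProduct, ← inner_mulVec_mulVec]
    have hne : WithLp.toLp 2 (M *ᵥ x.ofLp) ≠ 0 := fun h0 => hMx (congrArg WithLp.ofLp h0)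
    exact re_inner_self_pos (𝕜 := ℂ) |>.mpr hne
  P_J_P x := by
    change WithLp.toLp 2 ((Mᴴ * M) *ᵥ (Jmat L *ᵥ ((Mᴴ * M) *ᵥ x.ofLp))) =
      WithLp.toLp 2 (Jmat L *ᵥ x.ofLp)
    rw [mulVec_mulVec, mulVec_mulVec, gram_mul_Jmat_mul_gram hM]
  P_θ_P x := by
    change WithLp.toLp 2 ((Mᴴ * M) *ᵥ (Smat L *ᵥ star ((Mᴴ * M) *ᵥ x.ofLp))) =
      WithLp.toLp 2 (Smat L *ᵥ star x.ofLp)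
    rw [star_mulVec_eq, conjTranspose_mul, conjTranspose_conjTranspose, mulVec_mulVec,
      mulVec_mulVec, gram_mul_Smat_mul_gram hM]

lemma exists_diagonalizing_columns {M : Matrix (Fin L ⊕ Fin L) (Fin L ⊕ Fin L) ℂ}
    (hM : M ∈ Gset L) : ∃ (a : Fin (L / 2) → ℝ) (X : Matrix (Fin L ⊕ Fin L) (Fin L) ℂ),
      Antitone a ∧ (∀ i, 1 ≤ a i) ∧ Xᴴ * X = 1 ∧ Xᴴ * Jmat L * X = 0 ∧
      Smat L * Xᴴᵀ = X * Rmat L ∧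
      Mᴴ * M * X = X * diagonal fun i => (dvec L a i : ℂ) ^ 2 := by
  obtain ⟨a, c, ha, ha1, hc, hcJ, hcθ, hcP⟩ :=
    PolarTriple.exists_adapted (T := gramTriple hM) L (by simp [two_mul])
  refine ⟨a, of fun i j => c j i, ha, ha1, ?_, ?_, ?_, ?_⟩
  · ext i j
    have := hc i j
    rw [EuclideanSpace.inner_eq_star_dotProduct, dotProduct_comm] at this
    rw [one_apply, ← this]
    rfl
  · ext i j
    have := hcJ i j
    rw [EuclideanSpace.inner_eq_star_dotProduct, dotProduct_comm] at this
    rw [Matrix.zero_apply, ← this, Matrix.mul_assoc]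
    rfl
  · ext i j
    have := congrArg (fun x => x.ofLp i) (hcθ j (permFin L j) rfl)
    rw [mul_Rmat_apply]
    exact this
  · ext i j
    have := congrArg (fun x => x.ofLp i) (hcP j)
    rw [mul_diagonal]
    refine Eq.trans this ?_
    simp [mul_comm]

lemma exists_unitary_diagonalizing {M : Matrix (Fin L ⊕ Fin L) (Fin L ⊕ Fin L) ℂ}
    (hM : M ∈ Gset L) :
    ∃ (V : Matrix (Fin L ⊕ Fin L) (Fin L ⊕ Fin L) ℂ) (a : Fin (L / 2) → ℝ),
      V ∈ Gset L ∧ Vᴴ * V = 1 ∧ Antitone a ∧ (∀ i, 1 ≤ a i) ∧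
      Mᴴ * M * V = V * (Dmat L a * Dmat L a) := by
  obtain ⟨a, X, ha, ha1, hXX, hXJ, hXS, hXP⟩ := exists_diagonalizing_columns hM
  have h0 : ∀ i, (dvec L a i : ℂ) ≠ 0 := fun i => by
    exact_mod_cast dvec_ne_zero (fun i => (zero_lt_one.trans_le (ha1 i)).ne') i
  have hXP' : Mᴴ * M * (Jmat L * X) =
      Jmat L * X * diagonal fun i => ((dvec L a i : ℂ) ^ 2)⁻¹ := by
    have hX : X = Mᴴ * M * X * diagonal fun i => ((dvec L a i : ℂ) ^ 2)⁻¹ := by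
      rw [hXP, Matrix.mul_assoc, diagonal_mul_diagonal]
      simp [h0]
    calc Mᴴ * M * (Jmat L * X)
        = Mᴴ * M * (Jmat L * (Mᴴ * M * X * diagonal fun i => ((dvec L a i : ℂ) ^ 2)⁻¹)) := by
          rw [← hX]
      _ = (Mᴴ * M * Jmat L * (Mᴴ * M)) * X * diagonal fun i => ((dvec L a i : ℂ) ^ 2)⁻¹ := by
          simp only [Matrix.mul_assoc]
      _ = _ := by rw [gram_mul_Jmat_mul_gram hM]
  have hJV : Jmat L * fromCols X (Jmat L * X) = fromCols X (Jmat L * X) * Jmat L := by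
    nth_rw 4 [Jmat]
    rw [mul_fromCols, fromCols_mul_fromBlocks, ← Matrix.mul_assoc, Jmat_mul_Jmat]
    simp
  have hunit : (fromCols X (Jmat L * X))ᴴ * fromCols X (Jmat L * X) = 1 := by
    rw [conjTranspose_fromCols_eq_fromRows_conjTranspose, fromRows_mul_fromCols,
      conjTranspose_mul, Jmat_conjTranspose, ← fromBlocks_one, ← Matrix.mul_assoc Xᴴ, hXX, hXJ]
    congr 1
    · simp [hXJ]
    · rw [Matrix.mul_assoc, ← Matrix.mul_assoc (-Jmat L), Matrix.neg_mul, Jmat_mul_Jmat, neg_neg,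
        Matrix.one_mul, hXX]
  have hSV : Smat L * (fromCols X (Jmat L * X))ᴴᵀ = fromCols X (Jmat L * X) * Smat L := by
    have hSJ : Smat L * (Jmat L * X)ᴴᵀ = Jmat L * X * Rmat L := by
      rw [conjTranspose_mul, transpose_mul, Jmat_conjTranspose, transpose_neg, Jmat_transpose,
        neg_neg, ← Matrix.mul_assoc, Smat_mul_Jmat, Matrix.mul_assoc, hXS, Matrix.mul_assoc]
    have hcols : (fromCols X (Jmat L * X))ᴴᵀ = fromCols Xᴴᵀ (Jmat L * X)ᴴᵀ := by
      rw [conjTranspose_fromCols_eq_fromRows_conjTranspose, transpose_fromRows]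
    rw [hcols, mul_fromCols, hXS, hSJ]
    conv_rhs => rw [Smat, fromCols_mul_fromBlocks]
    simp
  refine ⟨fromCols X (Jmat L * X), a, ⟨?_, ?_⟩, hunit, ha, ha1, ?_⟩
  · rw [Matrix.mul_assoc, hJV, ← Matrix.mul_assoc, hunit, Matrix.one_mul]
  · have h1 : Smat L * fromCols X (Jmat L * X) = (fromCols X (Jmat L * X))ᴴᵀ * Smat L := by
      calc Smat L * fromCols X (Jmat L * X)
          = Smat L * (fromCols X (Jmat L * X) * Smat L) * Smat L := by
            simp only [Matrix.mul_assoc, Smat_mul_Smat, Matrix.mul_one]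
        _ = _ := by
            rw [← hSV, ← Matrix.mul_assoc, Smat_mul_Smat, Matrix.one_mul]
    rw [Matrix.mul_assoc, h1, ← Matrix.mul_assoc, ← transpose_mul, hunit, transpose_one,
      Matrix.one_mul]
  · rw [mul_fromCols, hXP, hXP', Dmat, fromBlocks_multiply, fromCols_mul_fromBlocks]
    simp only [diagonal_mul_diagonal, pow_two, mul_inv, Matrix.mul_zero, Matrix.zero_mul, zero_add,
      add_zero]

end Diagonalization

/-- polar-type decomposition in `𝔾`: every `M ∈ 𝔾` is `K D U` with
`K, U` unitary in `𝔾` of determinant one and `D = Dmat L a` diagonal with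
`a₁ ≥ … ≥ a_d ≥ 1`. -/
theorem Gset_polar_decomposition (L : ℕ) (hL : 0 < L)
    (M : Matrix (Fin L ⊕ Fin L) (Fin L ⊕ Fin L) ℂ) (hM : M ∈ Gset L) :
    ∃ (K U : Matrix (Fin L ⊕ Fin L) (Fin L ⊕ Fin L) ℂ) (a : Fin (L / 2) → ℝ),
      K ∈ Gset L ∧ Kᴴ * K = 1 ∧ K.det = 1 ∧
      U ∈ Gset L ∧ Uᴴ * U = 1 ∧ U.det = 1 ∧
      (∀ i j : Fin (L / 2), i ≤ j → a j ≤ a i) ∧ (∀ i, 1 ≤ a i) ∧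
      M = K * Dmat L a * U := by
  obtain ⟨V, a, hV, hVV, ha, ha1, hP⟩ := exists_unitary_diagonalizing hM
  have ha0 : ∀ i, a i ≠ 0 := fun i => (zero_lt_one.trans_le (ha1 i)).ne'
  have hVV' : V * Vᴴ = 1 := mul_eq_one_comm.mp hVV
  have hD := Dmat_mul_Dmat_inv ha0
  have hD' := mul_eq_one_comm.mp hD
  set D := Dmat L a
  set D' := Dmat L fun i => (a i)⁻¹
  have hU : Vᴴ ∈ Gset L := Gset_of_mul_eq_one hV hVV'
  have hUU : Vᴴᴴ * Vᴴ = 1 := by rw [conjTranspose_conjTranspose, hVV']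
  have hK : M * V * D' ∈ Gset L :=
    Gset_mul (Gset_mul hM hV) (Gset_of_mul_eq_one (Dmat_mem_Gset ha0) hD)
  have hKK : (M * V * D')ᴴ * (M * V * D') = 1 := by
    calc (M * V * D')ᴴ * (M * V * D') = D' * (Vᴴ * (Mᴴ * M * V)) * D' := by
          rw [conjTranspose_mul, conjTranspose_mul, show D'ᴴ = D' from Dmat_conjTranspose _]
          simp only [Matrix.mul_assoc]
      _ = (D' * D) * (D * D') := by
          rw [hP, ← Matrix.mul_assoc Vᴴ, hVV, Matrix.one_mul]
          simp only [Matrix.mul_assoc]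
      _ = 1 := by rw [hD, hD', Matrix.one_mul]
  refine ⟨M * V * D', Vᴴ, a, hK, hKK, det_eq_one_of_mem_Gset hK hKK, hU, hUU,
    det_eq_one_of_mem_Gset hU hUU, fun _ _ hij => ha hij, ha1, ?_⟩
  rw [Matrix.mul_assoc (M * V), hD', Matrix.mul_one, Matrix.mul_assoc, hVV', Matrix.mul_one]
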